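/- arXiv:2312.16666 — 2 statements merged into one kernel-verified Lean document; each statement's English description precedes it below -/
import Mathlib

section
/- Suppose W is finite with longest element w_S, let J ⊆ S and set J̄ = w_S·J·w_S. Then p_J := W_{J̄}·w_S·W_J is a core (J̄,J)-coset; it is the unique core (I,J)-coset (over all I ⊆ S) whose maximal element is w_S; and every core (I,J)-coset p satisfies p ≤_l p_J. -/
namespace CoxeterAtoms

variable {B : Type*} {W : Type*} [Group W] {M : CoxeterMatrix B}

/-- The standard parabolic subgroup `W_K` generated by the simple reflections indexed by `K`. -/
def par (cs : CoxeterSystem M W) (K : Set B) : Subgroup W :=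
  Subgroup.closure (cs.simple '' K)

/-- `K` is finitary if `W_K` is finite. -/
def Finitary (cs : CoxeterSystem M W) (K : Set B) : Prop :=
  ((par cs K : Set W)).Finite

/-- The left coset `W_I · x`. -/
def lcos (cs : CoxeterSystem M W) (I : Set B) (x : W) : Set W :=
  {w | ∃ a ∈ par cs I, w = a * x}

/-- The right coset `x · W_J`. -/
def rcos (cs : CoxeterSystem M W) (x : W) (J : Set B) : Set W :=
  {w | ∃ b ∈ par cs J, w = x * b}

/-- The double coset `W_I · x · W_J`. -/
def dcos (cs : CoxeterSystem M W) (I : Set B) (x : W) (J : Set B) : Set W :=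
  {w | ∃ a ∈ par cs I, ∃ b ∈ par cs J, w = a * x * b}

/-- `x` is a minimal length element of its double coset `W_I · x · W_J`. -/
def IsMinRep (cs : CoxeterSystem M W) (I : Set B) (x : W) (J : Set B) : Prop :=
  ∀ w ∈ dcos cs I x J, cs.length x ≤ cs.length w

/-- `y` is a maximal length element of the set `p`. -/
def IsMaxOf (cs : CoxeterSystem M W) (p : Set W) (y : W) : Prop :=
  y ∈ p ∧ ∀ w ∈ p, cs.length w ≤ cs.length y

/-- `y` is the longest element of the standard parabolic subgroup `W_K`. -/
def IsLongest (cs : CoxeterSystem M W) (K : Set B) (y : W) : Prop :=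
  y ∈ par cs K ∧ ∀ w ∈ par cs K, cs.length w ≤ cs.length y

/-- The double coset `W_I · x · W_J` is core: `W_I·x = W_I·x·W_J = x·W_J`. -/
def IsCore (cs : CoxeterSystem M W) (I : Set B) (x : W) (J : Set B) : Prop :=
  lcos cs I x = dcos cs I x J ∧ dcos cs I x J = rcos cs x J

/-- The left weak Bruhat order condition: `p ≤_l q`, where `p` is a core `(Ip,J)`-coset with
maximal element `pbar` and `q` a core coset (with the same right index `J`) with maximal
element `qbar`: there are a finitary `K` and `z : W` such that, with `r = W_K·z·W_{Ip}`,
one has `q̄ = r̄ · w_{Ip} · p̄` and `ℓ(q̄) = ℓ(r̄) − ℓ(w_{Ip}) + ℓ(p̄)`. -/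
def LeL (cs : CoxeterSystem M W) (Ip : Set B) (pbar qbar : W) : Prop :=
  ∃ wIp : W, IsLongest cs Ip wIp ∧
    ∃ K : Set B, Finitary cs K ∧ ∃ z rbar : W,
      IsMaxOf cs (dcos cs K z Ip) rbar ∧
      qbar = rbar * wIp * pbar ∧
      (cs.length qbar : ℤ) = (cs.length rbar : ℤ) - cs.length wIp + cs.length pbar

open Classical in
/-- The involution of `W × ZMod 2` attached to a simple reflection. -/
noncomputable def sgn (cs : CoxeterSystem M W) (i : B) : Equiv.Perm (W × ZMod 2) :=
  Function.Involutive.toPerm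
    (fun p => (cs.simple i * p.1 * cs.simple i, p.2 + if p.1 = cs.simple i then 1 else 0)) (by
      rintro ⟨t, e⟩
      have h2 : (1 : ZMod 2) + 1 = 0 := by decide
      by_cases h : t = cs.simple i
      · simp [h, add_assoc, h2]
      · have : ¬ (cs.simple i * t * cs.simple i = cs.simple i) := by
          intro h'
          apply h
          have h3 : cs.simple i * t = 1 := by simpa using h'
          have := eq_inv_of_mul_eq_one_right h3
          simpa using this
        simp only [h, this, if_false, add_zero]
        simp [mul_assoc])

open Classical in
theorem sgn_apply (cs : CoxeterSystem M W) (i : B) (t : W) (e : ZMod 2) :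
    sgn cs i (t, e) = (cs.simple i * t * cs.simple i, e + if t = cs.simple i then 1 else 0) := rfl

open Classical in
theorem sgn_pow (cs : CoxeterSystem M W) (i j : B) (k : ℕ) (t : W) (e : ZMod 2) :
    ((sgn cs i * sgn cs j) ^ k) (t, e) =
      ((cs.simple i * cs.simple j) ^ k * t * ((cs.simple i * cs.simple j) ^ k)⁻¹,
        e + ∑ l ∈ Finset.range (2 * k),
          if t = cs.simple j * (cs.simple i * cs.simple j) ^ l then 1 else 0) := by
  induction k with
  | zero => simp
  | succ k ih =>
    rw [pow_succ', Equiv.Perm.mul_apply, ih, Equiv.Perm.mul_apply, sgn_apply, sgn_apply]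
    set r := cs.simple i * cs.simple j with hr
    have hj : cs.simple j * r = r⁻¹ * cs.simple j := by simp [hr, mul_assoc]
    have hjk : ∀ k : ℕ, cs.simple j * r ^ k = (r ^ k)⁻¹ * cs.simple j := by
      intro k
      induction k with
      | zero => simp
      | succ k ih =>
        rw [pow_succ, ← mul_assoc, ih, mul_assoc, hj, ← mul_assoc, ← mul_inv_rev, ← pow_succ', pow_succ]
    have e1 : (r ^ k * t * (r ^ k)⁻¹ = cs.simple j) ↔ t = cs.simple j * r ^ (2 * k) := by
      rw [two_mul, pow_add, ← mul_assoc, hjk]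
      constructor
      · intro h; rw [← h]; group
      · intro h; rw [h]; group
    have e2 : (cs.simple j * (r ^ k * t * (r ^ k)⁻¹) * cs.simple j = cs.simple i) ↔
        t = cs.simple j * r ^ (2 * k + 1) := by
      have hi : cs.simple i = r * cs.simple j := by simp [hr]
      have : cs.simple j * r ^ (2 * k + 1) = (r ^ k)⁻¹ * (cs.simple j * r) * r ^ k := by
        rw [show 2 * k + 1 = k + (1 + k) by ring, pow_add, ← mul_assoc, hjk, pow_add]
        simp [mul_assoc]
      rw [this, hi]
      constructor
      · intro h
        have h3 : cs.simple j * (r ^ k * t * (r ^ k)⁻¹) = r := mul_right_cancel h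
        have h4 : r ^ k * t * (r ^ k)⁻¹ = cs.simple j * r := by
          calc _ = cs.simple j * (cs.simple j * (r ^ k * t * (r ^ k)⁻¹)) := by simp
            _ = _ := by rw [h3]
        rw [← h4]; group
      · intro h; rw [h]
        have : r ^ k * ((r ^ k)⁻¹ * (cs.simple j * r) * r ^ k) * (r ^ k)⁻¹ = cs.simple j * r := by group
        rw [this]; simp
    rw [show 2 * (k + 1) = 2 * k + 1 + 1 by ring, Finset.sum_range_succ, Finset.sum_range_succ]
    refine Prod.ext ?_ ?_
    · simp only [pow_succ' r k, mul_inv_rev]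
      simp [hr, mul_assoc]
    · simp only [e1, e2, add_assoc]

theorem sgn_liftable (cs : CoxeterSystem M W) : M.IsLiftable (sgn cs) := by
  classical
  intro i j
  ext1 ⟨t, e⟩
  rw [sgn_pow, cs.simple_mul_simple_pow i j, two_mul, Finset.sum_range_add]
  have h2 : ∀ x : ZMod 2, x + x = 0 := by decide
  simp [pow_add, h2]

/-- The sign representation on `W × ZMod 2`. -/
noncomputable def Phi (cs : CoxeterSystem M W) : W →* Equiv.Perm (W × ZMod 2) :=
  cs.lift ⟨sgn cs, sgn_liftable cs⟩

theorem Phi_simple (cs : CoxeterSystem M W) (i : B) : Phi cs (cs.simple i) = sgn cs i :=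
  cs.lift_apply_simple (sgn_liftable cs) i

open Classical in
theorem Phi_word (cs : CoxeterSystem M W) (ω : List B) (t : W) (e : ZMod 2) :
    Phi cs (cs.wordProd ω) (t, e) =
      (cs.wordProd ω * t * (cs.wordProd ω)⁻¹, e + ((cs.rightInvSeq ω).count t : ZMod 2)) := by
  induction ω with
  | nil => simp
  | cons i ω ih =>
    rw [cs.wordProd_cons, map_mul, Equiv.Perm.mul_apply, ih, Phi_simple, sgn_apply]
    refine Prod.ext ?_ ?_
    · simp [mul_assoc]
    · have : (cs.wordProd ω * t * (cs.wordProd ω)⁻¹ = cs.simple i) ↔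
          ((cs.wordProd ω)⁻¹ * cs.simple i * cs.wordProd ω = t) := by
        constructor
        · intro h; rw [← h]; group
        · intro h; rw [← h]; group
      simp only [CoxeterSystem.rightInvSeq, List.count_cons, this, beq_iff_eq]
      push_cast
      ring

/-- The exchange property. -/
theorem exch (cs : CoxeterSystem M W) (ω : List B) (i : B)
    (h : cs.length (cs.wordProd ω * cs.simple i) < cs.length (cs.wordProd ω)) :
    ∃ j < ω.length, cs.wordProd ω * cs.simple i = cs.wordProd (ω.eraseIdx j) := by
  classical
  obtain ⟨τ, hτ, hτ'⟩ := cs.exists_isReduced (cs.wordProd ω * cs.simple i)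
  have hw : cs.wordProd (τ ++ [i]) = cs.wordProd ω := by
    rw [cs.wordProd_append, ← hτ']; simp
  have hred : cs.IsReduced (τ ++ [i]) := by
    have h1 := cs.length_mul_simple (cs.wordProd ω) i
    have h2 := hτ.eq
    rw [← hτ'] at h2
    unfold CoxeterSystem.IsReduced
    rw [hw]
    simp
    omega
  have hnd := hred.nodup_rightInvSeq
  have hmem : cs.simple i ∈ cs.rightInvSeq (τ ++ [i]) := by
    rw [← List.concat_eq_append, cs.rightInvSeq_concat]; simp
  have hc := List.count_eq_one_of_mem hnd hmem
  have h1 := Phi_word cs (τ ++ [i]) (cs.simple i) 0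
  rw [hw, Phi_word cs ω, hc] at h1
  have h2 := (Prod.ext_iff.1 h1).2
  simp only [zero_add] at h2
  have hmem' : cs.simple i ∈ cs.rightInvSeq ω := by
    by_contra hn
    rw [List.count_eq_zero_of_not_mem hn] at h2
    revert h2; decide
  obtain ⟨j, hj, hje⟩ := List.getElem_of_mem hmem'
  refine ⟨j, by simpa using hj, ?_⟩
  rw [← cs.wordProd_mul_getD_rightInvSeq, List.getD_eq_getElem _ _ hj, hje]

theorem exists_red (cs : CoxeterSystem M W) (K : Set B) (a : W) (ha : a ∈ par cs K) :
    ∃ ω : List B, (∀ i ∈ ω, i ∈ K) ∧ cs.IsReduced ω ∧ cs.wordProd ω = a := by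
  have step : ∀ (x : W) (i : B), i ∈ K →
      (∃ ω : List B, (∀ i ∈ ω, i ∈ K) ∧ cs.IsReduced ω ∧ cs.wordProd ω = x) →
      (∃ ω : List B, (∀ i ∈ ω, i ∈ K) ∧ cs.IsReduced ω ∧ cs.wordProd ω = x * cs.simple i) := by
    rintro x i hi ⟨ω, h1, h2, rfl⟩
    have h2e := h2.eq
    rcases cs.length_mul_simple (cs.wordProd ω) i with h | h
    · refine ⟨ω ++ [i], ?_, ?_, ?_⟩
      · intro k hk
        rcases List.mem_append.1 hk with hk | hk
        · exact h1 k hk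
        · rw [List.mem_singleton.1 hk]; exact hi
      · unfold CoxeterSystem.IsReduced
        rw [cs.wordProd_append]
        simp
        omega
      · rw [cs.wordProd_append]; simp
    · obtain ⟨j, hj, hje⟩ := exch cs ω i (by omega)
      refine ⟨ω.eraseIdx j, fun k hk => h1 k (List.mem_of_mem_eraseIdx hk), ?_, hje.symm⟩
      unfold CoxeterSystem.IsReduced
      rw [← hje, List.length_eraseIdx_of_lt hj]
      omega
  unfold par at ha
  induction ha using Subgroup.closure_induction_right with
  | one => exact ⟨[], by simp, by simp [CoxeterSystem.IsReduced], by simp⟩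
  | mul_right x hx y hy ih =>
    obtain ⟨i, hi, rfl⟩ := hy
    exact step x i hi ih
  | mul_inv_cancel x hx y hy ih =>
    obtain ⟨i, hi, rfl⟩ := hy
    rw [cs.inv_simple]
    exact step x i hi ih

theorem len_desc (cs : CoxeterSystem M W) (I : Set B) (x : W)
    (hx : ∀ i ∈ I, cs.length (x * cs.simple i) < cs.length x) (a : W) (ha : a ∈ par cs I) :
    cs.length (x * a) + cs.length a = cs.length x := by
  have key : ∀ ω : List B, (∀ i ∈ ω, i ∈ I) → cs.IsReduced ω →
      ∃ y, x = y * cs.wordProd ω ∧ cs.length y + ω.length ≤ cs.length x := by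
    intro ω
    induction ω using List.reverseRecOn with
    | nil => intro _ _; exact ⟨x, by simp, by simp⟩
    | append_singleton τ i ih =>
      intro h1 h2
      have h2e := h2.eq
      have hτ : cs.IsReduced τ := by simpa using h2.take τ.length
      obtain ⟨y, hy, hyl⟩ := ih (fun k hk => h1 k (by simp [hk])) hτ
      obtain ⟨σ, hσ, rfl⟩ := cs.exists_isReduced y
      have hσe := hσ.eq
      have hxi := hx i (h1 i (by simp))
      have hxw : x = cs.wordProd (σ ++ τ) := by rw [hy, cs.wordProd_append]
      rw [hxw] at hxi
      obtain ⟨j, hj, hje⟩ := exch cs (σ ++ τ) i hxi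
      rw [← hxw] at hje
      rcases lt_or_ge j σ.length with hlt | hge
      · rw [List.eraseIdx_append_of_lt_length hlt, cs.wordProd_append] at hje
        refine ⟨cs.wordProd (σ.eraseIdx j), ?_, ?_⟩
        · rw [cs.wordProd_append, ← mul_assoc, ← hje]; simp
        · have := cs.length_wordProd_le (σ.eraseIdx j)
          rw [List.length_eraseIdx_of_lt hlt] at this
          simp
          omega
      · exfalso
        rw [List.eraseIdx_append_of_length_le hge, cs.wordProd_append, hy, mul_assoc] at hje
        have h3 := mul_left_cancel hje
        have h4 := cs.length_wordProd_le (τ.eraseIdx (j - σ.length))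
        rw [List.length_append] at hj
        rw [← h3, List.length_eraseIdx_of_lt (by omega)] at h4
        rw [cs.wordProd_append] at h2e
        simp at h2e
        omega
  obtain ⟨ω, h1, h2, h3⟩ := exists_red cs I a⁻¹ (inv_mem ha)
  obtain ⟨y, hy, hyl⟩ := key ω h1 h2
  have h2e := h2.eq
  rw [h3, cs.length_inv] at h2e
  rw [h3] at hy
  have hxa : x * a = y := by rw [hy]; group
  have := cs.length_le_length_mul_add_right x a
  rw [hxa] at *
  omega

theorem simple_mem_par (cs : CoxeterSystem M W) (K : Set B) (i : B)
    (h : cs.simple i ∈ par cs K) : cs.simple i ∈ cs.simple '' K := by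
  obtain ⟨ω, h1, h2, h3⟩ := exists_red cs K _ h
  have h2e := h2.eq
  rw [h3, cs.length_simple] at h2e
  obtain ⟨k, rfl⟩ := List.length_eq_one_iff.1 h2e.symm
  refine ⟨k, h1 k (by simp), ?_⟩
  simpa using h3

theorem simple_image_eq (cs : CoxeterSystem M W) (I K : Set B) (h : par cs I = par cs K) :
    cs.simple '' I = cs.simple '' K := by
  apply Set.Subset.antisymm
  · rintro _ ⟨i, hi, rfl⟩
    apply simple_mem_par
    rw [← h]
    exact Subgroup.subset_closure ⟨i, hi, rfl⟩
  · rintro _ ⟨i, hi, rfl⟩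
    apply simple_mem_par
    rw [h]
    exact Subgroup.subset_closure ⟨i, hi, rfl⟩

theorem core_of_conj (cs : CoxeterSystem M W) (I J : Set B) (x : W)
    (h : ∀ a, a ∈ par cs I ↔ x⁻¹ * a * x ∈ par cs J) : IsCore cs I x J := by
  have hl : ∀ b ∈ par cs J, x * b * x⁻¹ ∈ par cs I := by
    intro b hb; rw [h]; convert hb using 1; group
  constructor
  · ext w; constructor
    · rintro ⟨a, ha, rfl⟩
      exact ⟨a, ha, 1, one_mem _, by simp⟩
    · rintro ⟨a, ha, b, hb, rfl⟩
      exact ⟨a * (x * b * x⁻¹), mul_mem ha (hl b hb), by group⟩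
  · ext w; constructor
    · rintro ⟨a, ha, b, hb, rfl⟩
      exact ⟨(x⁻¹ * a * x) * b, mul_mem ((h a).1 ha) hb, by group⟩
    · rintro ⟨b, hb, rfl⟩
      exact ⟨1, one_mem _, b, hb, by simp⟩

theorem conj_of_core (cs : CoxeterSystem M W) (I J : Set B) (x : W) (h : IsCore cs I x J) (a : W) :
    a ∈ par cs I ↔ x⁻¹ * a * x ∈ par cs J := by
  have h' : lcos cs I x = rcos cs x J := h.1.trans h.2
  constructor
  · intro ha
    have : a * x ∈ rcos cs x J := by rw [← h']; exact ⟨a, ha, rfl⟩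
    obtain ⟨b, hb, hab⟩ := this
    rw [mul_assoc, hab]; simpa using hb
  · intro hb
    have : a * x ∈ lcos cs I x := by rw [h']; exact ⟨_, hb, by group⟩
    obtain ⟨c, hc, hac⟩ := this
    rwa [mul_right_cancel hac]

theorem statement_1 (cs : CoxeterSystem M W) [Finite W] (wS : W)
    (hwS : ∀ w : W, cs.length w ≤ cs.length wS)
    (J Jbar : Set B)
    (hJbar : cs.simple '' Jbar = (fun v => wS * v * wS) '' (cs.simple '' J)) :
    -- `p_J = W_{J̄}·w_S·W_J` is a core `(J̄,J)`-coset
    IsCore cs Jbar wS J ∧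
    -- it is the unique core `(I,J)`-coset with maximal element `w_S`
    (∀ (I : Set B) (y : W), IsCore cs I y J → IsMaxOf cs (dcos cs I y J) wS →
      dcos cs I y J = dcos cs Jbar wS J ∧ cs.simple '' I = cs.simple '' Jbar) ∧
    -- every core `(I,J)`-coset `p` satisfies `p ≤_l p_J`
    (∀ (I : Set B) (y pbar : W), IsCore cs I y J →
      IsMaxOf cs (dcos cs I y J) pbar → LeL cs I pbar wS) := by
  have htop : ∀ a, a ∈ par cs Set.univ := by
    intro a
    unfold par
    rw [Set.image_univ, cs.subgroup_closure_range_simple]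
    trivial
  have hS : ∀ a, cs.length (wS * a) + cs.length a = cs.length wS := by
    intro a
    refine len_desc cs Set.univ wS ?_ a (htop a)
    intro i _
    exact lt_of_le_of_ne (hwS _) (cs.length_mul_simple_ne _ _)
  have hinv : wS⁻¹ = wS := by
    have := hS wS
    have h0 : cs.length (wS * wS) = 0 := by omega
    rw [cs.length_eq_zero_iff] at h0
    exact inv_eq_of_mul_eq_one_right h0
  have hpar : par cs Jbar = (par cs J).map (MulAut.conj wS).toMonoidHom := by
    unfold par
    rw [MonoidHom.map_closure, hJbar]
    congr 1
    ext w
    simp [hinv]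
  have hconj : ∀ a, a ∈ par cs Jbar ↔ wS⁻¹ * a * wS ∈ par cs J := by
    intro a
    rw [hpar, Subgroup.mem_map]
    constructor
    · rintro ⟨b, hb, rfl⟩
      convert hb using 1
      simp [mul_assoc]
    · intro h
      exact ⟨_, h, by simp [mul_assoc]⟩
  have hcore := core_of_conj cs Jbar J wS hconj
  refine ⟨hcore, ?_, ?_⟩
  · intro I y hy hmax
    have hyc := conj_of_core cs I J y hy
    have hm := hmax.1
    rw [hy.2] at hm
    obtain ⟨b, hb, hb'⟩ := hm
    constructor
    · rw [hy.2, hcore.2]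
      ext w; constructor
      · rintro ⟨c, hc, rfl⟩
        exact ⟨b⁻¹ * c, mul_mem (inv_mem hb) hc, by rw [hb']; group⟩
      · rintro ⟨c, hc, rfl⟩
        exact ⟨b * c, mul_mem hb hc, by rw [hb']; group⟩
    · apply simple_image_eq
      ext a
      rw [hyc, hconj, hb']
      have : (y * b)⁻¹ * a * (y * b) = b⁻¹ * (y⁻¹ * a * y) * b := by group
      rw [this, Subgroup.mul_mem_cancel_right _ hb, Subgroup.mul_mem_cancel_left _ (inv_mem hb)]
  · intro I y pbar hy hmax
    have hp : ∀ a ∈ par cs I, cs.length (a * pbar) + cs.length a = cs.length pbar := by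
      intro a ha
      have := len_desc cs I pbar⁻¹ ?_ a⁻¹ (inv_mem ha)
      · rwa [← mul_inv_rev, cs.length_inv, cs.length_inv, cs.length_inv] at this
      · intro i hi
        refine lt_of_le_of_ne ?_ (cs.length_mul_simple_ne _ _)
        have e : pbar⁻¹ * cs.simple i = (cs.simple i * pbar)⁻¹ := by simp
        rw [e, cs.length_inv, cs.length_inv]
        apply hmax.2
        obtain ⟨a, ha, b, hb, hab⟩ := hmax.1
        refine ⟨cs.simple i * a, mul_mem (Subgroup.subset_closure ⟨i, hi, rfl⟩) ha, b, hb, ?_⟩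
        rw [hab]; group
    obtain ⟨wI, hwI, hwImax⟩ := Set.exists_max_image (par cs I : Set W) cs.length
      (Set.toFinite _) ⟨1, one_mem _⟩
    have hwI' : wI ∈ par cs I := hwI
    have hww : wI * wI = 1 := by
      have h1 := len_desc cs I wI ?_ wI hwI'
      · rw [← cs.length_eq_zero_iff]; omega
      · intro i hi
        exact lt_of_le_of_ne
          (hwImax _ (mul_mem hwI' (Subgroup.subset_closure ⟨i, hi, rfl⟩)))
          (cs.length_mul_simple_ne _ _)
    have hlen : ∀ a ∈ par cs I,
        cs.length (wS * pbar⁻¹ * a) + cs.length pbar = cs.length wS + cs.length a := by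
      intro a ha
      have h1 := hS (pbar⁻¹ * a)
      have h2 := hp a⁻¹ (inv_mem ha)
      have e : pbar⁻¹ * a = (a⁻¹ * pbar)⁻¹ := by group
      rw [mul_assoc]
      have e2 : cs.length (pbar⁻¹ * a) = cs.length (a⁻¹ * pbar) := by rw [e, cs.length_inv]
      rw [cs.length_inv] at h2
      omega
    refine ⟨wI, ⟨hwI, hwImax⟩, ∅, Set.toFinite _, wS * pbar⁻¹ * wI, wS * pbar⁻¹ * wI, ⟨?_, ?_⟩, ?_, ?_⟩
    · exact ⟨1, one_mem _, 1, one_mem _, by simp⟩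
    · rintro _ ⟨a, ha, b, hb, rfl⟩
      have ha1 : a = 1 := by simpa [par] using ha
      have h1 := hlen wI hwI'
      have h2 := hlen (wI * b) (mul_mem hwI' hb)
      have h3 := hwImax (wI * b) (mul_mem hwI' hb)
      rw [← mul_assoc] at h2
      rw [ha1, one_mul]
      omega
    · rw [mul_assoc _ wI wI, hww]; group
    · have h1 := hlen wI hwI'
      omega

end CoxeterAtoms
end

section
/- Let I, J, K ⊆ S be finitary, let p be a core (I,J)-coset and q a core (J,K)-coset, and suppose the composition of p and q is reduced. Then ℓ(p̲·q̲·w_K) = ℓ(p̲) + ℓ(q̲) + ℓ(w_K); the double coset r := W_I·p̄·w_J·q̄·W_K is a core (I,K)-coset; its minimal element is r̲ = p̲·q̲ (so in particular ℓ(p̲·q̲) = ℓ(p̲) + ℓ(q̲)), and its maximal element is r̄ = p̄·w_J·q̄ = p̲·q̲·w_K. -/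
namespace CoxeterAtoms

variable {B : Type*} {W : Type*} [Group W] {M : CoxeterMatrix B}

open Classical in
/-- The signed conjugation action of a simple reflection. -/
noncomputable def act (cs : CoxeterSystem M W) (i : B) : Function.End (W × ZMod 2) :=
  fun x => (cs.simple i * x.1 * cs.simple i, x.2 + if x.1 = cs.simple i then 1 else 0)

open Classical in
theorem act_pow (cs : CoxeterSystem M W) (i j : B) (k : ℕ) (t : W) (e : ZMod 2) :
    ((act cs i * act cs j) ^ k) (t, e) =
      ((cs.simple i * cs.simple j) ^ k * t * ((cs.simple i * cs.simple j) ^ k)⁻¹,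
        e + ∑ n ∈ Finset.range (2 * k),
          if t = cs.simple j * (cs.simple i * cs.simple j) ^ n then 1 else 0) := by
  induction k with
  | zero => simp; rfl
  | succ k ih =>
    have key : ∀ n : ℕ, ((cs.simple i * cs.simple j) ^ n)⁻¹ * cs.simple j =
        cs.simple j * (cs.simple i * cs.simple j) ^ n := by
      intro n
      induction n with
      | zero => simp
      | succ n ih =>
        rw [pow_succ', mul_inv_rev, mul_inv_rev, cs.inv_simple, cs.inv_simple]
        have : ((cs.simple i * cs.simple j) ^ n)⁻¹ * (cs.simple j * cs.simple i) * cs.simple j =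
          (((cs.simple i * cs.simple j) ^ n)⁻¹ * cs.simple j) * (cs.simple i * cs.simple j) := by
          group
        rw [this, ih, mul_assoc, ← pow_succ, ← pow_succ']
    rw [pow_succ']
    change (act cs i * act cs j) (((act cs i * act cs j) ^ k) (t, e)) = _
    rw [ih]
    change act cs i (act cs j _) = _
    set x := cs.simple i * cs.simple j with hx
    have h1 : (x ^ k * t * (x ^ k)⁻¹ = cs.simple j) ↔ t = cs.simple j * x ^ (2 * k) := by
      rw [two_mul, pow_add, ← mul_assoc, ← key]
      constructor
      · intro h; rw [← h]; group
      · intro h; rw [h]; group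
    have h2 : (cs.simple j * (x ^ k * t * (x ^ k)⁻¹) * cs.simple j = cs.simple i) ↔
        t = cs.simple j * x ^ (2 * k + 1) := by
      have e1 : cs.simple j * x ^ (2 * k + 1) =
          (x ^ k)⁻¹ * (cs.simple j * cs.simple i * cs.simple j) * x ^ k := by
        rw [show 2 * k + 1 = k + (1 + k) by ring, pow_add, ← mul_assoc, ← key, pow_add, pow_one]
        simp only [hx, mul_assoc]
      rw [e1]
      constructor
      · intro h; rw [← h]
        simp only [mul_assoc, CoxeterSystem.simple_mul_simple_cancel_left]
        simp [← mul_assoc]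
      · intro h; rw [h]; simp [mul_assoc]
    simp only [act, h1, h2]
    rw [show 2 * (k + 1) = 2 * k + 1 + 1 by ring, Finset.sum_range_succ, Finset.sum_range_succ]
    refine Prod.ext ?_ ?_
    · simp only [pow_succ', hx, mul_inv_rev, cs.inv_simple, mul_assoc]
    · simp only [add_assoc]

theorem act_liftable (cs : CoxeterSystem M W) : M.IsLiftable (act cs) := by
  classical
  intro i j
  funext ⟨t, e⟩
  rw [act_pow, cs.simple_mul_simple_pow, two_mul, Finset.sum_range_add]
  simp only [pow_add, cs.simple_mul_simple_pow, one_mul, CharTwo.add_self_eq_zero]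
  simp
  rfl

noncomputable def phi (cs : CoxeterSystem M W) : W →* Function.End (W × ZMod 2) :=
  cs.lift ⟨act cs, act_liftable cs⟩

noncomputable def eta (cs : CoxeterSystem M W) (w t : W) : ZMod 2 := (phi cs w (t, 0)).2

theorem phi_simple (cs : CoxeterSystem M W) (i : B) : phi cs (cs.simple i) = act cs i :=
  cs.lift_apply_simple _ i

theorem phi_mul (cs : CoxeterSystem M W) (u v : W) (x) : phi cs (u * v) x = phi cs u (phi cs v x) := by
  rw [map_mul]; rfl

theorem eta_one (cs : CoxeterSystem M W) (t : W) : eta cs 1 t = 0 := by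
  rw [eta, map_one]; rfl

theorem phi_apply (cs : CoxeterSystem M W) (w t : W) (e : ZMod 2) :
    phi cs w (t, e) = (w * t * w⁻¹, e + eta cs w t) := by
  have : ∀ t e, phi cs w (t, e) = (w * t * w⁻¹, e + eta cs w t) := by
    apply cs.simple_induction_left w
    · intro t e; simp [eta_one]; rfl
    · intro w i ih t e
      have h : eta cs (cs.simple i * w) t = (act cs i (w * t * w⁻¹, 0 + eta cs w t)).2 := by
        rw [eta, phi_mul, ih, phi_simple]
      rw [phi_mul, ih, phi_simple, h]
      simp [act, mul_assoc, add_assoc]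
  exact this t e

theorem eta_mul (cs : CoxeterSystem M W) (u v t : W) :
    eta cs (u * v) t = eta cs v t + eta cs u (v * t * v⁻¹) := by
  rw [eta, phi_mul, phi_apply, phi_apply]; simp

theorem eta_simple (cs : CoxeterSystem M W) (i : B) : eta cs (cs.simple i) (cs.simple i) = 1 := by
  simp [eta, phi_simple, act]

theorem eta_simple_ne (cs : CoxeterSystem M W) (i : B) (t : W) (h : t ≠ cs.simple i) :
    eta cs (cs.simple i) t = 0 := by
  simp [eta, phi_simple, act, h]

theorem eta_refl (cs : CoxeterSystem M W) (t : W) (ht : cs.IsReflection t) : eta cs t t = 1 := by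
  obtain ⟨u, i, rfl⟩ := ht
  have h := eta_mul cs u u⁻¹ (u * cs.simple i * u⁻¹)
  rw [mul_inv_cancel, eta_one] at h
  rw [eta_mul, eta_mul]
  have e1 : u⁻¹ * (u * cs.simple i * u⁻¹) * u⁻¹⁻¹ = cs.simple i := by group
  rw [e1] at h ⊢
  rw [eta_simple, cs.inv_simple, cs.simple_mul_simple_self, one_mul]
  rw [add_left_comm, ← h, add_zero]

theorem mem_ris (cs : CoxeterSystem M W) (ω : List B) (t : W) (h : eta cs (cs.wordProd ω) t ≠ 0) :
    t ∈ cs.rightInvSeq ω := by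
  induction ω with
  | nil => simp [eta_one] at h
  | cons i ω ih =>
    rw [cs.wordProd_cons, eta_mul] at h
    rw [CoxeterSystem.rightInvSeq, List.mem_cons]
    by_cases h0 : eta cs (cs.wordProd ω) t = 0
    · left
      by_contra hne
      rw [h0, zero_add] at h
      apply h
      apply eta_simple_ne
      intro h3
      apply hne
      rw [← h3]; group
    · exact Or.inr (ih h0)

theorem lt_of_eta (cs : CoxeterSystem M W) (w t : W) (h : eta cs w t ≠ 0) :
    cs.length (w * t) < cs.length w := by
  obtain ⟨ω, hω, rfl⟩ := cs.exists_isReduced w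
  exact (cs.isRightInversion_of_mem_rightInvSeq hω (mem_ris cs ω t h)).2

/-- Strong exchange. -/
theorem strong_exchange (cs : CoxeterSystem M W) (ω : List B) (t : W) (ht : cs.IsReflection t)
    (h : cs.length (cs.wordProd ω * t) < cs.length (cs.wordProd ω)) :
    t ∈ cs.rightInvSeq ω := by
  apply mem_ris
  intro h0
  have := lt_of_eta cs (cs.wordProd ω * t) t (by
    rw [eta_mul, eta_refl cs t ht, mul_inv_cancel_right, h0]; simp)
  rw [mul_assoc, ht.mul_self, mul_one] at this
  omega

theorem erase_of_mem (cs : CoxeterSystem M W) (ω : List B) (t : W) (h : t ∈ cs.rightInvSeq ω) :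
    ∃ k < ω.length, cs.wordProd ω * t = cs.wordProd (ω.eraseIdx k) := by
  obtain ⟨k, hk, rfl⟩ := List.getElem_of_mem h
  refine ⟨k, by simpa using hk, ?_⟩
  rw [← cs.wordProd_mul_getD_rightInvSeq, List.getD_eq_getElem _ _ hk]

theorem ris_append (cs : CoxeterSystem M W) (ρ ω : List B) (t : W)
    (h : t ∈ cs.rightInvSeq (ρ ++ ω)) :
    t ∈ cs.rightInvSeq ω ∨ cs.wordProd ω * t * (cs.wordProd ω)⁻¹ ∈ cs.rightInvSeq ρ := by
  induction ρ with
  | nil => exact Or.inl h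
  | cons i ρ ih =>
    rw [List.cons_append, CoxeterSystem.rightInvSeq, List.mem_cons] at h
    rw [CoxeterSystem.rightInvSeq, List.mem_cons]
    rcases h with h | h
    · right; left; rw [h, cs.wordProd_append]; group
    · rcases ih h with h | h
      · exact Or.inl h
      · exact Or.inr (Or.inr h)

/-- Two-factor form of strong exchange. -/
theorem exchange2 (cs : CoxeterSystem M W) (u v t : W) (ht : cs.IsReflection t)
    (h : cs.length (u * v * t) < cs.length (u * v)) :
    cs.length (v * t) < cs.length v ∨
      cs.length (u * (v * t * v⁻¹)) < cs.length u := by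
  obtain ⟨ρ, hρ, rfl⟩ := cs.exists_isReduced u
  obtain ⟨ω, hω, rfl⟩ := cs.exists_isReduced v
  rw [← cs.wordProd_append] at h
  rcases ris_append cs _ _ _ (strong_exchange cs _ t ht h) with h | h
  · exact Or.inl (cs.isRightInversion_of_mem_rightInvSeq hω h).2
  · exact Or.inr (cs.isRightInversion_of_mem_rightInvSeq hρ h).2

theorem simple_mem (cs : CoxeterSystem M W) {J : Set B} {i : B} (hi : i ∈ J) :
    cs.simple i ∈ par cs J := Subgroup.subset_closure ⟨i, hi, rfl⟩

/-- Induction along reduced expressions inside a parabolic subgroup. -/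
theorem par_induction (cs : CoxeterSystem M W) (J : Set B) (P : W → Prop) (h1 : P 1)
    (hs : ∀ x i, x ∈ par cs J → i ∈ J → cs.length (x * cs.simple i) = cs.length x + 1 →
      P x → P (x * cs.simple i)) (x : W) (hx : x ∈ par cs J) : P x := by
  have word : ∃ ω : List B, (∀ i ∈ ω, i ∈ J) ∧ cs.IsReduced ω ∧ x = cs.wordProd ω := by
    have step : ∀ y i, i ∈ J →
        (∃ ω : List B, (∀ i ∈ ω, i ∈ J) ∧ cs.IsReduced ω ∧ y = cs.wordProd ω) →
        ∃ ω : List B, (∀ i ∈ ω, i ∈ J) ∧ cs.IsReduced ω ∧ y * cs.simple i = cs.wordProd ω := by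
      rintro y i hi ⟨ω, hω, hr, rfl⟩
      rcases cs.length_mul_simple (cs.wordProd ω) i with h | h
      · refine ⟨ω.concat i, ?_, ?_, (cs.wordProd_concat i ω).symm⟩
        · intro j hj
          simp only [List.concat_eq_append, List.mem_append, List.mem_singleton] at hj
          rcases hj with hj | rfl
          · exact hω j hj
          · exact hi
        · rw [CoxeterSystem.IsReduced, cs.wordProd_concat, h, hr.eq]; simp
      · obtain ⟨k, hk, e⟩ := erase_of_mem cs ω _ (strong_exchange cs ω (cs.simple i)
          (cs.isReflection_simple i) (by omega))
        refine ⟨ω.eraseIdx k, fun j hj => hω j (List.mem_of_mem_eraseIdx hj), ?_, e⟩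
        rw [CoxeterSystem.IsReduced, ← e, List.length_eraseIdx_of_lt hk, ← hr.eq]
        omega
    refine Subgroup.closure_induction_right ?_ ?_ ?_ hx
    · exact ⟨[], by simp, by simp [CoxeterSystem.IsReduced], by simp⟩
    · rintro y _ _ ⟨i, hi, rfl⟩ h
      exact step y i hi h
    · rintro y _ _ ⟨i, hi, rfl⟩ h
      rw [cs.inv_simple]
      exact step y i hi h
  obtain ⟨ω, hω, hr, rfl⟩ := word
  clear hx
  induction ω using List.reverseRecOn with
  | nil => simpa using h1
  | append_singleton ω i ih =>
    have hr' : cs.IsReduced ω := by simpa using hr.take ω.length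
    have hω' : ∀ j ∈ ω, j ∈ J := fun j hj => hω j (by simp [hj])
    rw [cs.wordProd_append, cs.wordProd_singleton]
    apply hs _ _ _ (hω i (by simp)) _ (ih hω' hr')
    · apply Subgroup.list_prod_mem
      intro y hy
      obtain ⟨j, hj, rfl⟩ := List.mem_map.1 hy
      exact simple_mem cs (hω' j hj)
    · have := hr.eq
      rw [cs.wordProd_append, cs.wordProd_singleton] at this
      rw [this, hr'.eq]; simp

theorem length_min_mul (cs : CoxeterSystem M W) (J : Set B) (p : W)
    (hp : ∀ x ∈ par cs J, cs.length p ≤ cs.length (p * x)) (x : W) (hx : x ∈ par cs J) :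
    cs.length (p * x) = cs.length p + cs.length x := by
  refine par_induction cs J (fun x => cs.length (p * x) = cs.length p + cs.length x)
    (by simp) ?_ x hx
  intro x i hx hi hl ih
  rw [← mul_assoc]
  rcases cs.length_mul_simple (p * x) i with h | h
  · omega
  · exfalso
    rcases exchange2 cs p x (cs.simple i) (cs.isReflection_simple i) (by omega) with h | h
    · omega
    · have := hp (x * cs.simple i * x⁻¹)
        (mul_mem (mul_mem hx (simple_mem cs hi)) (inv_mem hx))
      omega

theorem length_longest (cs : CoxeterSystem M W) (J : Set B) (w : W) (hw : IsLongest cs J w)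
    (x : W) (hx : x ∈ par cs J) : cs.length (w * x) + cs.length x = cs.length w := by
  refine par_induction cs J (fun x => cs.length (w * x) + cs.length x = cs.length w)
    (by simp) ?_ x hx
  intro x i hx hi hl ih
  have hm : x * cs.simple i * x⁻¹ ∈ par cs J :=
    mul_mem (mul_mem hx (simple_mem cs hi)) (inv_mem hx)
  have hrefl : cs.IsReflection (x * cs.simple i * x⁻¹) := ⟨x, i, rfl⟩
  have hlt : cs.length (w * (x * cs.simple i * x⁻¹)) < cs.length w :=
    lt_of_le_of_ne (hw.2 _ (mul_mem hw.1 hm)) (hrefl.length_mul_left_ne w)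
  have := exchange2 cs (w * x) x⁻¹ _ hrefl (by simpa [mul_assoc] using hlt)
  rcases this with h | h
  · exfalso
    have e : x⁻¹ * (x * cs.simple i * x⁻¹) = (x * cs.simple i)⁻¹ := by
      rw [mul_inv_rev, cs.inv_simple]; group
    rw [e, cs.length_inv, cs.length_inv] at h
    omega
  · have e : w * x * (x⁻¹ * (x * cs.simple i * x⁻¹) * x⁻¹⁻¹) = w * x * cs.simple i := by group
    rw [e] at h
    rw [← mul_assoc]
    rcases cs.length_mul_simple (w * x) i with h' | h' <;> omega

theorem longest_unique (cs : CoxeterSystem M W) (J : Set B) (w v : W) (hw : IsLongest cs J w)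
    (hv : IsLongest cs J v) : v = w := by
  have h := length_longest cs J w hw (w⁻¹ * v) (mul_mem (inv_mem hw.1) hv.1)
  rw [mul_inv_cancel_left] at h
  have h2 := hv.2 w hw.1
  have h3 : cs.length (w⁻¹ * v) = 0 := by omega
  rw [cs.length_eq_zero_iff, inv_mul_eq_one] at h3
  exact h3.symm

theorem longest_mul_self (cs : CoxeterSystem M W) (J : Set B) (w : W) (hw : IsLongest cs J w) :
    w * w = 1 := by
  have h := longest_unique cs J w w⁻¹ hw ⟨inv_mem hw.1, by simpa using hw.2⟩
  nth_rw 1 [← h]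
  simp

theorem length_right (cs : CoxeterSystem M W) (I J : Set B) (p : W) (hp : IsMinRep cs I p J)
    (x : W) (hx : x ∈ par cs J) : cs.length (p * x) = cs.length p + cs.length x :=
  length_min_mul cs J p (fun x hx => hp _ ⟨1, one_mem _, x, hx, by simp⟩) x hx

theorem length_left (cs : CoxeterSystem M W) (I J : Set B) (p : W) (hp : IsMinRep cs I p J)
    (x : W) (hx : x ∈ par cs I) : cs.length (x * p) = cs.length x + cs.length p := by
  have := length_min_mul cs I p⁻¹ (fun x hx => by
    have := hp (x⁻¹ * p) ⟨x⁻¹, inv_mem hx, 1, one_mem _, by simp⟩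
    rw [← cs.length_inv (x⁻¹ * p)] at this
    simpa using this) x⁻¹ (inv_mem hx)
  rw [← mul_inv_rev] at this
  simp only [cs.length_inv] at this
  omega

/-- The maximal element of a core coset. -/
theorem max_right (cs : CoxeterSystem M W) (I J : Set B) (p w y : W) (hp : IsMinRep cs I p J)
    (hc : IsCore cs I p J) (hw : IsLongest cs J w) (hy : IsMaxOf cs (dcos cs I p J) y) :
    y = p * w := by
  obtain ⟨hy1, hy2⟩ := hy
  rw [hc.2] at hy1 hy2
  obtain ⟨x, hx, rfl⟩ := hy1
  rw [longest_unique cs J w x hw]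
  refine ⟨hx, fun z hz => ?_⟩
  have := hy2 (p * z) ⟨z, hz, rfl⟩
  rw [length_right cs I J p hp z hz, length_right cs I J p hp x hx] at this
  omega

theorem max_left (cs : CoxeterSystem M W) (I J : Set B) (p w y : W) (hp : IsMinRep cs I p J)
    (hc : IsCore cs I p J) (hw : IsLongest cs I w) (hy : IsMaxOf cs (dcos cs I p J) y) :
    y = w * p := by
  obtain ⟨hy1, hy2⟩ := hy
  rw [← hc.1] at hy1 hy2
  obtain ⟨x, hx, rfl⟩ := hy1
  rw [longest_unique cs I w x hw]
  refine ⟨hx, fun z hz => ?_⟩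
  have := hy2 (z * p) ⟨z, hz, rfl⟩
  rw [length_left cs I J p hp z hz, length_left cs I J p hp x hx] at this
  omega

theorem statement_3 (cs : CoxeterSystem M W) (I J K : Set B)
    (hI : Finitary cs I) (hJ : Finitary cs J) (hK : Finitary cs K)
    (wJ wK : W) (hwJ : IsLongest cs J wJ) (hwK : IsLongest cs K wK)
    (pm qm pbar qbar : W)
    (hpmin : IsMinRep cs I pm J) (hpcore : IsCore cs I pm J)
    (hpmax : IsMaxOf cs (dcos cs I pm J) pbar)
    (hqmin : IsMinRep cs J qm K) (hqcore : IsCore cs J qm K)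
    (hqmax : IsMaxOf cs (dcos cs J qm K) qbar)
    (hred : (cs.length (pbar * wJ * qbar) : ℤ) =
      (cs.length pbar : ℤ) - cs.length wJ + cs.length qbar) :
    cs.length (pm * qm * wK) = cs.length pm + cs.length qm + cs.length wK ∧
    IsCore cs I (pbar * wJ * qbar) K ∧
    (pm * qm ∈ dcos cs I (pbar * wJ * qbar) K ∧ IsMinRep cs I (pm * qm) K) ∧
    cs.length (pm * qm) = cs.length pm + cs.length qm ∧
    IsMaxOf cs (dcos cs I (pbar * wJ * qbar) K) (pbar * wJ * qbar) ∧
    pbar * wJ * qbar = pm * qm * wK := by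
  have e1 := max_right cs I J pm wJ pbar hpmin hpcore hwJ hpmax
  have e2 := max_left cs J K qm wJ qbar hqmin hqcore hwJ hqmax
  have e3 := max_right cs J K qm wK qbar hqmin hqcore hwK hqmax
  have sqJ := longest_mul_self cs J wJ hwJ
  have eq : pbar * wJ * qbar = pm * qm * wK := by
    rw [e1, mul_assoc pm wJ wJ, sqJ, mul_one, e3, mul_assoc]
  have l1 := length_right cs I J pm hpmin wJ hwJ.1
  have l2 := length_left cs J K qm hqmin wJ hwJ.1
  have l3 := length_right cs J K qm hqmin wK hwK.1
  rw [← e1] at l1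
  rw [← e2] at l2
  rw [← e3] at l3
  rw [eq] at hred ⊢
  have L : cs.length (pm * qm * wK) = cs.length pm + cs.length qm + cs.length wK := by omega
  have L2 : cs.length (pm * qm) = cs.length pm + cs.length qm := by
    have a := cs.length_mul_le (pm * qm) wK
    have b := cs.length_mul_le pm qm
    omega
  -- lengths along the coset
  have L3 : ∀ x ∈ par cs K, cs.length (pm * qm * x) = cs.length (pm * qm) + cs.length x := by
    intro x hx
    have a := cs.length_mul_le (pm * qm) x
    have b := cs.length_mul_le (pm * qm * x) (x⁻¹ * wK)
    have c := length_longest cs K wK⁻¹ ⟨inv_mem hwK.1, by simpa using hwK.2⟩ x hx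
    rw [show wK⁻¹ * x = (x⁻¹ * wK)⁻¹ by group, cs.length_inv, cs.length_inv] at c
    rw [show pm * qm * x * (x⁻¹ * wK) = pm * qm * wK by group] at b
    omega
  -- moving parabolic elements across
  have mv : ∀ (I J : Set B) (p : W), IsCore cs I p J → ∀ a ∈ par cs I, ∃ b ∈ par cs J, a * p = p * b := by
    intro I J p h a ha
    have : a * p ∈ rcos cs p J := by rw [← h.2, ← h.1]; exact ⟨a, ha, rfl⟩
    exact this
  have mv' : ∀ (I J : Set B) (p : W), IsCore cs I p J → ∀ b ∈ par cs J, ∃ a ∈ par cs I, p * b = a * p := by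
    intro I J p h a ha
    have : p * a ∈ lcos cs I p := by rw [h.1, h.2]; exact ⟨a, ha, rfl⟩
    exact this
  have mr : ∀ a ∈ par cs I, ∃ b ∈ par cs K, a * (pm * qm) = pm * qm * b := by
    intro a ha
    obtain ⟨b, hb, h⟩ := mv I J pm hpcore a ha
    obtain ⟨c, hc, h'⟩ := mv J K qm hqcore b hb
    exact ⟨c, hc, by rw [← mul_assoc, h, mul_assoc, h', mul_assoc]⟩
  have mr' : ∀ b ∈ par cs K, ∃ a ∈ par cs I, pm * qm * b = a * (pm * qm) := by
    intro a ha
    obtain ⟨b, hb, h⟩ := mv' J K qm hqcore a ha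
    obtain ⟨c, hc, h'⟩ := mv' I J pm hpcore b hb
    exact ⟨c, hc, by rw [mul_assoc, h, ← mul_assoc, h', mul_assoc]⟩
  have hr : ∀ k ∈ par cs K, ∀ w ∈ dcos cs I (pm * qm * k) K, ∃ b ∈ par cs K, w = pm * qm * b := by
    rintro k hk w ⟨a, ha, b, hb, rfl⟩
    obtain ⟨c, hc, h⟩ := mr a ha
    exact ⟨c * k * b, mul_mem (mul_mem hc hk) hb, by
      rw [← mul_assoc a, h]; group⟩
  refine ⟨L, ⟨?_, ?_⟩, ⟨?_, ?_⟩, L2, ⟨?_, ?_⟩, rfl⟩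
  · apply Set.Subset.antisymm
    · rintro w ⟨a, ha, rfl⟩
      exact ⟨a, ha, 1, one_mem _, by simp⟩
    · intro w hw
      obtain ⟨b, hb, rfl⟩ := hr wK hwK.1 w hw
      obtain ⟨a, ha, h⟩ := mr' (b * wK⁻¹) (mul_mem hb (inv_mem hwK.1))
      exact ⟨a, ha, by rw [← mul_assoc a, ← h]; group⟩
  · apply Set.Subset.antisymm
    · intro w hw
      obtain ⟨b, hb, rfl⟩ := hr wK hwK.1 w hw
      exact ⟨wK⁻¹ * b, mul_mem (inv_mem hwK.1) hb, by group⟩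
    · rintro w ⟨a, ha, rfl⟩
      exact ⟨1, one_mem _, a, ha, by simp⟩
  · exact ⟨1, one_mem _, wK⁻¹, inv_mem hwK.1, by group⟩
  · intro w hw
    obtain ⟨b, hb, rfl⟩ := hr 1 (one_mem _) w (by simpa using hw)
    rw [L3 b hb]; omega
  · exact ⟨1, one_mem _, 1, one_mem _, by group⟩
  · intro w hw
    obtain ⟨b, hb, rfl⟩ := hr wK hwK.1 w hw
    rw [L3 b hb, L3 wK hwK.1]
    have := hwK.2 b hb
    omega

end CoxeterAtoms
end
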